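/- arXiv:2402.08826 — 11 statements merged into one kernel-verified Lean document; each statement's English description precedes it below -/
import Mathlib

section
/- (Price conditions for full participation, constant case) Fix k* ∈ {1,2,…,K}. There exists an equilibrium at buyer threshold k* with α = 1 at price P > 0 if and only if ξ(k*) < P ≤ ξ(k*+1) and P ≥ P*(k*), where for k* = K the condition P ≤ ξ(K+1) is vacuous (interpreting B_{K+1} = +∞). -/
open Finset

/-- Amount of data bought by buyer `k` at price `P` when the participation rate is `α`:
`N_k(α) = min(αN, B_k/P)`. -/
noncomputable def Nk (N P α : ℝ) (B : ℕ → ℝ) (k : ℕ) : ℝ := min (α * N) (B k / P)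

/-- Total amount of data bought by the `K` buyers. -/
noncomputable def totalN (K : ℕ) (N P α : ℝ) (B : ℕ → ℝ) : ℝ :=
  ∑ k ∈ Finset.Icc 1 K, Nk N P α B k

/-- Cumulative budget `B_{≤m} = Σ_{k=1}^m B_k` (so `B_{≤0} = 0`). -/
noncomputable def Bleq (B : ℕ → ℝ) (m : ℕ) : ℝ := ∑ k ∈ Finset.Icc 1 m, B k

/-- Equilibrium condition with constant benefit `Q` and privacy valuations
uniform on `[0,1]`: `α = min(1, αNQ / Σ_k N_k(α))`. -/
def eqCond (K : ℕ) (B : ℕ → ℝ) (N Q P α : ℝ) : Prop :=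
  α = min 1 (α * N * Q / totalN K N P α B)

/-- Equilibrium condition with linear benefit `Q(α) = CαN`:
`α = min(1, Cα²N² / Σ_k N_k(α))`. -/
def eqCondLin (K : ℕ) (B : ℕ → ℝ) (N C P α : ℝ) : Prop :=
  α = min 1 (C * α ^ 2 * N ^ 2 / totalN K N P α B)

/-- The equilibrium is at buyer threshold `k*`: `N_k(α) < αN` for `1 ≤ k ≤ k*` and
`N_k(α) = αN` for `k* < k ≤ K`. -/
def atThr (K : ℕ) (B : ℕ → ℝ) (N P α : ℝ) (kstar : ℕ) : Prop :=
  (∀ k, 1 ≤ k → k ≤ kstar → Nk N P α B k < α * N) ∧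
  (∀ k, kstar < k → k ≤ K → Nk N P α B k = α * N)

/-- Price conditions for full participation, constant case: for
`k* ∈ {1,…,K}` (with `Q > K − k*`), there is an equilibrium at buyer threshold `k*`
with `α = 1` at price `P > 0` iff `ξ(k*) < P ≤ ξ(k*+1)` (the upper bound being
vacuous when `k* = K`, interpreting `B_{K+1} = +∞`) and `P ≥ P*(k*)`. -/
theorem full_price_conditions_constant
    (K : ℕ) (hK : 1 ≤ K) (B : ℕ → ℝ)
    (hB1 : 0 < B 1) (hBmono : ∀ k, 1 ≤ k → k < K → B k ≤ B (k + 1))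
    (N Q : ℝ) (hN : 0 < N)
    (kstar : ℕ) (hks1 : 1 ≤ kstar) (hksK : kstar ≤ K)
    (hQ : (K : ℝ) - (kstar : ℝ) < Q)
    (P : ℝ) (hP : 0 < P) :
    (eqCond K B N Q P 1 ∧ atThr K B N P 1 kstar) ↔
      (B kstar / N < P ∧ (kstar < K → P ≤ B (kstar + 1) / N) ∧
        Bleq B kstar / (N * (Q - ((K : ℝ) - (kstar : ℝ)))) ≤ P) := by
  have mono : ∀ j, ∀ i, 1 ≤ i → i ≤ j → j ≤ K → B i ≤ B j := by
    intro j i hi hij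
    induction j, hij using Nat.le_induction with
    | base => intro _; exact le_rfl
    | succ n hn ih =>
      intro h
      exact (ih (by omega)).trans (hBmono n (by omega) (by omega))
  have hpos : ∀ k, 1 ≤ k → k ≤ K → 0 < B k := fun k h1 h2 =>
    lt_of_lt_of_le hB1 (mono k 1 le_rfl h1 h2)
  have hlt : ∀ k, Nk N P 1 B k < 1 * N ↔ B k < P * N := by
    intro k
    unfold Nk
    rw [min_lt_iff, div_lt_iff₀ hP]
    constructor
    · rintro (h | h)
      · exact absurd h (lt_irrefl _)
      · linarith
    · intro h
      right
      linarith
  have heq : ∀ k, Nk N P 1 B k = 1 * N ↔ P * N ≤ B k := by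
    intro k
    unfold Nk
    rw [min_eq_left_iff, le_div_iff₀ hP]
    constructor <;> intro h <;> linarith
  have hthr : atThr K B N P 1 kstar ↔
      (B kstar / N < P ∧ (kstar < K → P ≤ B (kstar + 1) / N)) := by
    unfold atThr
    rw [div_lt_iff₀ hN, le_div_iff₀ hN]
    simp only [hlt, heq]
    constructor
    · rintro ⟨h1, h2⟩
      exact ⟨h1 kstar hks1 le_rfl, fun h => h2 _ (by omega) (by omega)⟩
    · rintro ⟨h1, h2⟩
      exact ⟨fun k a b => (mono kstar k a b hksK).trans_lt h1,
        fun k a b => (h2 (by omega)).trans (mono k (kstar + 1) (by omega) (by omega) b)⟩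
  rw [← and_assoc, ← hthr, and_comm]
  refine and_congr_right fun ht => ?_
  have htot : totalN K N P 1 B = Bleq B kstar / P + ((K : ℝ) - kstar) * N := by
    unfold totalN Bleq
    have hsplit : Finset.Icc 1 K = Finset.Icc 1 kstar ∪ Finset.Ioc kstar K := by
      ext x
      simp only [Finset.mem_union, Finset.mem_Icc, Finset.mem_Ioc]
      omega
    have hdis : Disjoint (Finset.Icc 1 kstar) (Finset.Ioc kstar K) := by
      rw [Finset.disjoint_left]
      intro x
      simp only [Finset.mem_Icc, Finset.mem_Ioc]
      omega
    rw [hsplit, Finset.sum_union hdis, Finset.sum_div]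
    congr 1
    · refine Finset.sum_congr rfl fun k hk => ?_
      rw [Finset.mem_Icc] at hk
      have h := (hlt k).1 (ht.1 k hk.1 hk.2)
      unfold Nk
      apply min_eq_right
      rw [div_le_iff₀ hP]
      linarith
    · have : ∀ k ∈ Finset.Ioc kstar K, Nk N P 1 B k = N := by
        intro k hk
        rw [Finset.mem_Ioc] at hk
        simpa using ht.2 k hk.1 hk.2
      rw [Finset.sum_congr rfl this, Finset.sum_const, Nat.card_Ioc, nsmul_eq_mul,
        Nat.cast_sub hksK]
  have htpos : 0 < totalN K N P 1 B := by
    unfold totalN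
    refine Finset.sum_pos (fun k hk => ?_) ⟨1, by simp [hK]⟩
    rw [Finset.mem_Icc] at hk
    have := hpos k hk.1 hk.2
    unfold Nk
    apply lt_min <;> positivity
  have hD : 0 < N * (Q - ((K : ℝ) - kstar)) := mul_pos hN (by linarith)
  unfold eqCond
  rw [eq_comm, min_eq_left_iff, le_div_iff₀ htpos, htot, div_le_iff₀ hD]
  have hc : Bleq B kstar ≤ P * (N * (Q - ((K : ℝ) - kstar))) ↔
      Bleq B kstar / P ≤ N * (Q - ((K : ℝ) - kstar)) := by
    rw [div_le_iff₀ hP, mul_comm P]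
  rw [hc]
  constructor <;> intro h <;> linarith
end

section
/- (Ordering of equilibrium types, constant moderate-benefit case) Suppose B_{≤K}/B_K ≤ Q < K. Then there does not exist k* with 0 < k* < K such that both (i) there exists a price P > 0 and an equilibrium at buyer threshold k* with α = 1, and (ii) there exists a price P' > 0 and an equilibrium at buyer threshold k*+1 with 0 < α < 1. -/
open Finset

/-- Ordering of equilibrium types, constant moderate-benefit case:
suppose `B_{≤K}/B_K ≤ Q < K`. Then no `k*` with `0 < k* < K` simultaneously admits
(at some price) a full-participation equilibrium at threshold `k*` and (at some
price) a partial-participation equilibrium at threshold `k*+1`. -/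
theorem ordering_equilibrium_types_constant
    (K : ℕ) (hK : 1 ≤ K) (B : ℕ → ℝ)
    (hB1 : 0 < B 1) (hBmono : ∀ k, 1 ≤ k → k < K → B k ≤ B (k + 1))
    (N Q : ℝ) (hN : 0 < N)
    (hQlo : Bleq B K / B K ≤ Q) (hQhi : Q < (K : ℝ)) :
    ¬ ∃ kstar : ℕ, 0 < kstar ∧ kstar < K ∧
      (∃ P : ℝ, 0 < P ∧ eqCond K B N Q P 1 ∧ atThr K B N P 1 kstar) ∧
      (∃ P' : ℝ, 0 < P' ∧ ∃ α : ℝ, 0 < α ∧ α < 1 ∧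
        eqCond K B N Q P' α ∧ atThr K B N P' α (kstar + 1)) := by
  rintro ⟨k, hk0, hkK, ⟨P, hP, he1, ht1⟩, ⟨P', hP', a, ha0, ha1, he2, ht2⟩⟩
  have hpos : ∀ j, 1 ≤ j → j ≤ K → 0 < B j := by
    intro j hj
    induction j, hj using Nat.le_induction with
    | base => intro _; exact hB1
    | succ n hn ih =>
      intro h
      exact lt_of_lt_of_le (ih (by omega)) (hBmono n hn (by omega))
  have h1 : Nk N P 1 B (k + 1) = 1 * N := ht1.2 (k + 1) (by omega) (by omega)
  have h2 : Nk N P' a B (k + 1) < a * N := ht2.1 (k + 1) (by omega) le_rfl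
  unfold Nk at h1 h2
  have h1' : 1 * N ≤ B (k + 1) / P := min_eq_left_iff.mp h1
  have h2' : B (k + 1) / P' < a * N := by
    rcases min_lt_iff.mp h2 with h | h
    · exact absurd h (lt_irrefl _)
    · exact h
  rw [le_div_iff₀ hP] at h1'
  rw [div_lt_iff₀ hP'] at h2'
  have hPP : P ≤ a * P' := by
    have : N * P < N * (a * P') := by nlinarith
    exact (lt_of_mul_lt_mul_left this hN.le).le
  have hT1pos : 0 < totalN K N P 1 B := by
    unfold totalN
    apply Finset.sum_pos
    · intro j hj
      rw [Finset.mem_Icc] at hj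
      exact lt_min (by linarith) (div_pos (hpos j hj.1 hj.2) hP)
    · exact ⟨1, Finset.mem_Icc.mpr ⟨le_rfl, hK⟩⟩
  have hT1 : totalN K N P 1 B ≤ N * Q := by
    have h : (1 : ℝ) ≤ 1 * N * Q / totalN K N P 1 B := min_eq_left_iff.mp he1.symm
    rw [le_div_iff₀ hT1pos] at h
    linarith
  have hT : totalN K N P' a B ≤ a * totalN K N P 1 B := by
    unfold totalN
    rw [Finset.mul_sum]
    apply Finset.sum_le_sum
    intro j hj
    rw [Finset.mem_Icc] at hj
    have hb := hpos j hj.1 hj.2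
    unfold Nk
    rw [mul_min_of_nonneg _ _ ha0.le]
    apply min_le_min
    · linarith
    · rw [← mul_div_assoc, div_le_div_iff₀ hP' hP]
      nlinarith
  have hT2 : a = a * N * Q / totalN K N P' a B := by
    rcases min_choice (1 : ℝ) (a * N * Q / totalN K N P' a B) with h | h
    · have := he2.trans h
      linarith
    · exact he2.trans h
  have hne : totalN K N P' a B ≠ 0 := by
    intro h
    rw [h, div_zero] at hT2
    linarith
  rw [eq_div_iff hne] at hT2
  have hT3 : totalN K N P' a B = N * Q := by
    apply mul_left_cancel₀ ha0.ne'
    linarith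
  nlinarith
end

section
/- (Partial participation at full buyer threshold, constant case) There exist a price P > 0 and an equilibrium at buyer threshold K with 0 < α < 1 if and only if Q·B_K < B_{≤K}; moreover, every price P inducing such an equilibrium equals P = B_{≤K}/(QN). -/
open Finset

/-- Partial participation at full buyer threshold, constant case:
there exist a price `P > 0` and an equilibrium at buyer threshold `K` with
`0 < α < 1` iff `Q·B_K < B_{≤K}`; moreover any price inducing such an equilibrium
equals `B_{≤K}/(QN)`. -/
theorem partial_at_full_threshold_constant
    (K : ℕ) (hK : 1 ≤ K) (B : ℕ → ℝ)
    (hB1 : 0 < B 1) (hBmono : ∀ k, 1 ≤ k → k < K → B k ≤ B (k + 1))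
    (N Q : ℝ) (hN : 0 < N) (hQ : 0 < Q) :
    ((∃ P : ℝ, 0 < P ∧ ∃ α : ℝ, 0 < α ∧ α < 1 ∧
        eqCond K B N Q P α ∧ atThr K B N P α K) ↔ Q * B K < Bleq B K) ∧
    (∀ P : ℝ, 0 < P →
      (∃ α : ℝ, 0 < α ∧ α < 1 ∧ eqCond K B N Q P α ∧ atThr K B N P α K) →
      P = Bleq B K / (Q * N)) := by
  have hmono : ∀ k, 1 ≤ k → k ≤ K → ∀ j, 1 ≤ j → j ≤ k → B j ≤ B k := by
    intro k hk
    induction k, hk using Nat.le_induction with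
    | base =>
      intro _ j h1 h2
      have : j = 1 := by omega
      rw [this]
    | succ k hk ih =>
      intro hkK j h1 h2
      rcases Nat.lt_or_ge k j with h | h
      · have : j = k + 1 := by omega
        rw [this]
      · exact (ih (by omega) j h1 h).trans (hBmono k hk (by omega))
  have hpos : ∀ k, 1 ≤ k → k ≤ K → 0 < B k := fun k h1 h2 =>
    hB1.trans_le (hmono k h1 h2 1 le_rfl h1)
  have hS : 0 < Bleq B K := by
    unfold Bleq
    apply Finset.sum_pos
    · intro k hk
      rw [Finset.mem_Icc] at hk
      exact hpos k hk.1 hk.2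
    · exact ⟨1, Finset.mem_Icc.mpr ⟨le_rfl, hK⟩⟩
  have htot : ∀ P α : ℝ, atThr K B N P α K → totalN K N P α B = Bleq B K / P := by
    intro P α h
    unfold totalN Bleq
    rw [Finset.sum_div]
    apply Finset.sum_congr rfl
    intro k hk
    rw [Finset.mem_Icc] at hk
    have h1 := h.1 k hk.1 hk.2
    unfold Nk at h1 ⊢
    rcases min_lt_iff.mp h1 with h2 | h2
    · exact absurd h2 (lt_irrefl _)
    · exact min_eq_right h2.le
  have hprice : ∀ P : ℝ, 0 < P →
      (∃ α : ℝ, 0 < α ∧ α < 1 ∧ eqCond K B N Q P α ∧ atThr K B N P α K) →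
      P = Bleq B K / (Q * N) := by
    rintro P hP ⟨α, h0, h1, he, ht⟩
    unfold eqCond at he
    rw [htot P α ht] at he
    have h2 : α = α * N * Q / (Bleq B K / P) := by
      rcases min_choice 1 (α * N * Q / (Bleq B K / P)) with h | h
      · rw [h] at he; linarith
      · rw [h] at he; exact he
    rw [eq_div_iff (by positivity)] at h2
    have h3 : Bleq B K / P = N * Q := by
      apply mul_left_cancel₀ h0.ne'
      rw [h2]; ring
    rw [div_eq_iff hP.ne'] at h3
    rw [eq_div_iff (by positivity), h3]; ring
  refine ⟨⟨?_, ?_⟩, hprice⟩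
  · rintro ⟨P, hP, α, h0, h1, he, ht⟩
    have hp := hprice P hP ⟨α, h0, h1, he, ht⟩
    have h2 := ht.1 K hK le_rfl
    unfold Nk at h2
    rcases min_lt_iff.mp h2 with h3 | h3
    · exact absurd h3 (lt_irrefl _)
    · have h4 : B K / P < N := by nlinarith
      rw [div_lt_iff₀ hP] at h4
      rw [eq_div_iff (by positivity)] at hp
      nlinarith
  · intro h
    have hBK := hpos K hK le_rfl
    have hlt : Q * B K / Bleq B K < 1 := (div_lt_one hS).mpr h
    obtain ⟨α, ha, hb⟩ := exists_between hlt
    have h0 : 0 < α := lt_trans (by positivity) ha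
    have hP : 0 < Bleq B K / (Q * N) := by positivity
    have ht : atThr K B N (Bleq B K / (Q * N)) α K := by
      refine ⟨?_, fun k h1 h2 => by omega⟩
      intro k h1 h2
      unfold Nk
      apply min_lt_iff.mpr
      right
      have hk := hmono K hK le_rfl k h1 h2
      calc B k / (Bleq B K / (Q * N)) ≤ B K / (Bleq B K / (Q * N)) := by gcongr
        _ = Q * B K / Bleq B K * N := by field_simp
        _ < α * N := by gcongr
    refine ⟨_, hP, α, h0, hb, ?_, ht⟩
    unfold eqCond
    rw [htot _ _ ht]
    have : α * N * Q / (Bleq B K / (Bleq B K / (Q * N))) = α := by field_simp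
    rw [this, min_eq_right hb.le]
end

section
/- (Low benefit, constant case) Suppose Q < B_{≤K}/B_K, and set P̄ = B_{≤K}/(QN). Then: (i) for every price P > P̄, α = 1 is the unique equilibrium at price P among α ∈ (0,1]; (ii) for every 0 < P < P̄, there is a unique equilibrium at price P among α ∈ (0,1], it satisfies α < 1, and it is given by α = (1/(K−k)) · (Q − B_{≤k}/(PN)) where k is the unique integer with 0 ≤ k ≤ K−1 satisfying γ(k) < P ≤ γ(k+1); and (iii) at the price P = P̄, the set of equilibria among α ∈ (0,1] is exactly the interval [Q·B_K/B_{≤K}, 1]. -/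
open Finset

/-- `γ(k) = ((K−k)B_k + B_{≤k})/(QN)`. -/
noncomputable def gam (K : ℕ) (B : ℕ → ℝ) (Q N : ℝ) (k : ℕ) : ℝ :=
  (((K : ℝ) - (k : ℝ)) * B k + Bleq B k) / (Q * N)

theorem aux_mono (K : ℕ) (B : ℕ → ℝ) (hB0 : B 0 = 0) (hB1 : 0 < B 1)
    (hBmono : ∀ k, 1 ≤ k → k < K → B k ≤ B (k + 1)) (i j : ℕ) (hij : i ≤ j) (hj : j ≤ K) :
    B i ≤ B j := by
  induction j, hij using Nat.le_induction with
  | base => exact le_rfl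
  | succ n hn ih =>
    refine (ih (by omega)).trans ?_
    rcases Nat.eq_zero_or_pos n with h | h
    · subst h; rw [hB0]; exact hB1.le
    · exact hBmono n h (by omega)

theorem aux_gam_mono (K : ℕ) (B : ℕ → ℝ) (N Q : ℝ) (hN : 0 < N) (hQ : 0 < Q)
    (hm : ∀ i j : ℕ, i ≤ j → j ≤ K → B i ≤ B j) (i j : ℕ) (hij : i ≤ j) (hj : j ≤ K) :
    gam K B Q N i ≤ gam K B Q N j := by
  induction j, hij using Nat.le_induction with
  | base => exact le_rfl
  | succ n hn ih =>
    refine (ih (by omega)).trans ?_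
    unfold gam
    have h1 : Bleq B (n + 1) = Bleq B n + B (n + 1) := by
      unfold Bleq; rw [Finset.sum_Icc_succ_top (by omega)]
    have h2 := hm n (n + 1) (by omega) hj
    have h3 : (0 : ℝ) ≤ (K : ℝ) - n := by
      have : (n : ℝ) ≤ K := by exact_mod_cast (by omega : n ≤ K)
      linarith
    have h4 : 0 < Q * N := by positivity
    rw [h1]
    apply div_le_div_of_nonneg_right _ h4.le
    push_cast
    nlinarith [mul_le_mul_of_nonneg_left h2 h3]

theorem aux_eq (K : ℕ) (B : ℕ → ℝ) (N Q P α : ℝ) (hN : 0 < N) (hα : 0 < α) (hα1 : α ≤ 1)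
    (hT : 0 < totalN K N P α B) :
    eqCond K B N Q P α ↔
      (α = 1 ∧ totalN K N P α B ≤ N * Q) ∨ (α < 1 ∧ totalN K N P α B = N * Q) := by
  unfold eqCond
  generalize totalN K N P α B = T at *
  rcases hα1.eq_or_lt with h | h
  · subst h
    simp only [lt_irrefl, false_and, or_false, true_and, one_mul]
    rw [eq_comm, min_eq_left_iff, le_div_iff₀ hT, one_mul]
  · simp only [h.ne, false_and, false_or, h, true_and]
    constructor
    · intro h2
      rcases min_choice 1 (α * N * Q / T) with h3 | h3
      · rw [h3] at h2; exact absurd h2 h.ne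
      · rw [h3, eq_div_iff hT.ne', mul_assoc] at h2
        exact mul_left_cancel₀ hα.ne' h2
    · intro h2
      have : α * N * Q / T = α := by
        rw [div_eq_iff hT.ne', h2]; ring
      rw [this, min_eq_right hα1]

theorem aux_pos (K : ℕ) (hK : 1 ≤ K) (B : ℕ → ℝ) (N P α : ℝ) (hN : 0 < N) (hP : 0 < P)
    (hα : 0 < α) (hpos : ∀ i : ℕ, 1 ≤ i → i ≤ K → 0 < B i) : 0 < totalN K N P α B := by
  unfold totalN
  apply Finset.sum_pos
  · intro i hi
    rw [Finset.mem_Icc] at hi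
    exact lt_min (by positivity) (div_pos (hpos i hi.1 hi.2) hP)
  · exact ⟨1, by simp [hK]⟩

theorem aux_le (K : ℕ) (B : ℕ → ℝ) (N P α : ℝ) : totalN K N P α B ≤ Bleq B K / P := by
  unfold totalN Bleq
  rw [Finset.sum_div]
  exact Finset.sum_le_sum fun i _ => min_le_right _ _

theorem aux_full (K : ℕ) (B : ℕ → ℝ) (N P α : ℝ) (hP : 0 < P)
    (hm : ∀ i j : ℕ, i ≤ j → j ≤ K → B i ≤ B j) (h : B K / P ≤ α * N) :
    totalN K N P α B = Bleq B K / P := by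
  unfold totalN Bleq
  rw [Finset.sum_div]
  refine Finset.sum_congr rfl fun i hi => ?_
  rw [Finset.mem_Icc] at hi
  exact min_eq_right ((div_le_div_of_nonneg_right (hm i K hi.2 le_rfl) hP.le).trans h)

theorem aux_strict (K : ℕ) (hK : 1 ≤ K) (B : ℕ → ℝ) (N P α β : ℝ) (hN : 0 < N)
    (hαβ : α < β) (h : α * N < B K / P) :
    totalN K N P α B < totalN K N P β B := by
  unfold totalN
  have h1 : α * N < β * N := by nlinarith
  apply Finset.sum_lt_sum
  · intro i _
    exact min_le_min_right _ h1.le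
  · refine ⟨K, by simp [hK], ?_⟩
    unfold Nk
    rw [min_eq_left h.le]
    exact lt_min h1 h

theorem aux_inj (K : ℕ) (hK : 1 ≤ K) (B : ℕ → ℝ) (N P α β : ℝ) (hN : 0 < N) (hP : 0 < P)
    (hm : ∀ i j : ℕ, i ≤ j → j ≤ K → B i ≤ B j)
    (h1 : totalN K N P α B = totalN K N P β B) (h2 : totalN K N P α B < Bleq B K / P) :
    α = β := by
  rcases lt_trichotomy α β with h | h | h
  · rcases lt_or_ge (α * N) (B K / P) with h3 | h3
    · exact absurd h1 (aux_strict K hK B N P α β hN h h3).ne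
    · exact absurd (aux_full K B N P α hP hm h3) h2.ne
  · exact h
  · rcases lt_or_ge (β * N) (B K / P) with h3 | h3
    · exact absurd h1 (aux_strict K hK B N P β α hN h h3).ne'
    · exact absurd (aux_full K B N P β hP hm h3) (h1 ▸ h2).ne

theorem aux_split (K k : ℕ) (hk : k < K) (B : ℕ → ℝ) (N P α : ℝ) (hP : 0 < P)
    (hm : ∀ i j : ℕ, i ≤ j → j ≤ K → B i ≤ B j)
    (h1 : B k / P ≤ α * N) (h2 : α * N ≤ B (k + 1) / P) :
    totalN K N P α B = Bleq B k / P + ((K : ℝ) - k) * (α * N) := by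
  have key : ∀ n, k ≤ n → n ≤ K →
      ∑ i ∈ Finset.Icc 1 n, Nk N P α B i = Bleq B k / P + ((n : ℝ) - k) * (α * N) := by
    intro n hn
    induction n, hn using Nat.le_induction with
    | base =>
      intro hkK
      rw [sub_self, zero_mul, add_zero]
      exact aux_full k B N P α hP (fun i j hij hj => hm i j hij (by omega)) h1
    | succ n hn ih =>
      intro hnK
      rw [Finset.sum_Icc_succ_top (by omega), ih (by omega)]
      have : Nk N P α B (n + 1) = α * N :=
        min_eq_left (h2.trans (div_le_div_of_nonneg_right (hm (k+1) (n+1) (by omega) hnK) hP.le))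
      rw [this]; push_cast; ring
  exact key K hk.le le_rfl

theorem aux_one (K : ℕ) (B : ℕ → ℝ) (N Q P : ℝ) (hN : 0 < N) (hP : 0 < P)
    (hpos : ∀ i : ℕ, 1 ≤ i → i ≤ K → 0 < B i) (hBK : 0 < B K)
    (hm : ∀ i j : ℕ, i ≤ j → j ≤ K → B i ≤ B j)
    (hQlow : Q < Bleq B K / B K) (hPb : N * Q < Bleq B K / P) :
    N * Q < totalN K N P 1 B := by
  rcases le_or_gt (B K / P) (1 * N) with h | h
  · rw [aux_full K B N P 1 hP hm h]; exact hPb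
  · rw [one_mul, lt_div_iff₀ hP] at h
    have h1 : N * (Bleq B K / B K) ≤ totalN K N P 1 B := by
      unfold totalN Bleq
      rw [Finset.sum_div, Finset.mul_sum]
      refine Finset.sum_le_sum fun i hi => ?_
      rw [Finset.mem_Icc] at hi
      have hi0 := hpos i hi.1 hi.2
      refine le_min ?_ ?_
      · rw [one_mul]
        exact mul_le_of_le_one_right hN.le ((div_le_one hBK).2 (hm i K hi.2 le_rfl))
      · rw [← mul_div_assoc, div_le_div_iff₀ hBK hP]
        nlinarith
    exact (mul_lt_mul_of_pos_left hQlow hN).trans_le h1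

/-- Low benefit, constant case: suppose `Q < B_{≤K}/B_K` and set
`P̄ = B_{≤K}/(QN)`. Then (i) for `P > P̄`, `α = 1` is the unique equilibrium among
`α ∈ (0,1]`; (ii) for `0 < P < P̄`, there is a unique `k ∈ {0,…,K−1}` with
`γ(k) < P ≤ γ(k+1)` and the unique equilibrium among `α ∈ (0,1]` is
`α = (1/(K−k))·(Q − B_{≤k}/(PN)) < 1`; (iii) at `P = P̄`, the set of equilibria
among `α ∈ (0,1]` is exactly `[Q·B_K/B_{≤K}, 1]`. -/
theorem low_benefit_constant
    (K : ℕ) (hK : 1 ≤ K) (B : ℕ → ℝ)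
    (hB0 : B 0 = 0) (hB1 : 0 < B 1) (hBmono : ∀ k, 1 ≤ k → k < K → B k ≤ B (k + 1))
    (N Q : ℝ) (hN : 0 < N) (hQ : 0 < Q)
    (hQlow : Q < Bleq B K / B K) :
    (∀ P : ℝ, Bleq B K / (Q * N) < P → ∀ α : ℝ, 0 < α → α ≤ 1 →
      (eqCond K B N Q P α ↔ α = 1)) ∧
    (∀ P : ℝ, 0 < P → P < Bleq B K / (Q * N) →
      (∃! k : ℕ, k < K ∧ gam K B Q N k < P ∧ P ≤ gam K B Q N (k + 1)) ∧
      (∀ k : ℕ, k < K → gam K B Q N k < P → P ≤ gam K B Q N (k + 1) →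
        (1 / ((K : ℝ) - (k : ℝ))) * (Q - Bleq B k / (P * N)) < 1 ∧
        ∀ α : ℝ, 0 < α → α ≤ 1 →
          (eqCond K B N Q P α ↔
            α = (1 / ((K : ℝ) - (k : ℝ))) * (Q - Bleq B k / (P * N))))) ∧
    (∀ α : ℝ, 0 < α → α ≤ 1 →
      (eqCond K B N Q (Bleq B K / (Q * N)) α ↔
        (Q * B K / Bleq B K ≤ α ∧ α ≤ 1))) := by
  have hm := aux_mono K B hB0 hB1 hBmono
  have hpos : ∀ i : ℕ, 1 ≤ i → i ≤ K → 0 < B i := fun i h1 h2 => hB1.trans_le (hm 1 i h1 h2)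
  have hBK := hpos K hK le_rfl
  have hQN : 0 < Q * N := by positivity
  have hBl : 0 < Bleq B K := by
    unfold Bleq
    apply Finset.sum_pos
    · intro i hi
      rw [Finset.mem_Icc] at hi
      exact hpos i hi.1 hi.2
    · exact ⟨1, by simp [hK]⟩
  have hPbar : 0 < Bleq B K / (Q * N) := by positivity
  refine ⟨?_, ?_, ?_⟩
  · intro P hP α hα hα1
    have hP0 : 0 < P := hPbar.trans hP
    have hlt : totalN K N P α B < N * Q := by
      refine (aux_le K B N P α).trans_lt ?_
      rw [div_lt_iff₀ hQN] at hP
      rw [div_lt_iff₀ hP0]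
      linarith
    rw [aux_eq K B N Q P α hN hα hα1 (aux_pos K hK B N P α hN hP0 hα hpos)]
    constructor
    · rintro (h | h)
      · exact h.1
      · exact absurd h.2 hlt.ne
    · intro h
      exact Or.inl ⟨h, hlt.le⟩
  · intro P hP hPb
    have hPb' : N * Q < Bleq B K / P := by
      rw [lt_div_iff₀ hQN] at hPb
      rw [lt_div_iff₀ hP]
      linarith
    have hg := aux_gam_mono K B N Q hN hQ hm
    constructor
    · have hex : ∃ n : ℕ, P ≤ gam K B Q N n := by
        refine ⟨K, ?_⟩
        unfold gam
        rw [sub_self, zero_mul, zero_add]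
        exact hPb.le
      have hKle : P ≤ gam K B Q N K := by
        unfold gam
        rw [sub_self, zero_mul, zero_add]
        exact hPb.le
      have h0 : gam K B Q N 0 < P := by
        unfold gam Bleq
        simpa [hB0] using hP
      classical
      have hfs := Nat.find_spec hex
      have hfm := fun m => @Nat.find_min _ _ hex m
      have hfl := Nat.find_min' hex hKle
      generalize Nat.find hex = n at hfs hfm hfl
      rcases n with _ | n
      · exact absurd hfs (not_le.2 h0)
      · refine ⟨n, ⟨by omega, not_le.1 (hfm n (by omega)), hfs⟩, ?_⟩
        rintro k ⟨hk, hk1, hk2⟩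
        rcases lt_trichotomy k n with h | h | h
        · exact absurd hk2 (hfm (k + 1) (by omega))
        · exact h
        · exact absurd ((hfs.trans (hg (n + 1) k (by omega) hk.le))) (not_le.2 hk1)
    · intro k hk hk1 hk2
      have hKk : (0 : ℝ) < (K : ℝ) - k := by
        have : (k : ℝ) < K := by exact_mod_cast hk
        linarith
      have hPN : 0 < P * N := by positivity
      obtain ⟨a, ha⟩ : ∃ a, a = (1 / ((K : ℝ) - (k : ℝ))) * (Q - Bleq B k / (P * N)) := ⟨_, rfl⟩
      rw [← ha]
      have ha' : ((K : ℝ) - k) * (a * N) * P = Q * N * P - Bleq B k := by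
        rw [ha]; field_simp
      have hsucc : Bleq B (k + 1) = Bleq B k + B (k + 1) := by
        unfold Bleq; rw [Finset.sum_Icc_succ_top (by omega)]
      unfold gam at hk1 hk2
      rw [div_lt_iff₀ hQN] at hk1
      rw [le_div_iff₀ hQN, hsucc] at hk2
      push_cast at hk2
      have h1 : B k / P ≤ a * N := by
        rw [div_le_iff₀ hP]
        refine le_of_mul_le_mul_left ?_ hKk
        linarith
      have h2 : a * N ≤ B (k + 1) / P := by
        rw [le_div_iff₀ hP]
        refine le_of_mul_le_mul_left ?_ hKk
        linarith
      have hTa : totalN K N P a B = N * Q := by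
        rw [aux_split K k hk B N P a hP hm h1 h2]
        field_simp
        linarith
      have hone := aux_one K B N Q P hN hP hpos hBK hm hQlow hPb'
      have ha1 : a < 1 := by
        by_contra hcon
        rw [not_lt] at hcon
        have : totalN K N P 1 B ≤ totalN K N P a B := by
          unfold totalN
          exact Finset.sum_le_sum fun i _ =>
            min_le_min_right _ (mul_le_mul_of_nonneg_right hcon hN.le)
        linarith
      refine ⟨ha1, fun α hα hα1 => ?_⟩
      rw [aux_eq K B N Q P α hN hα hα1 (aux_pos K hK B N P α hN hP hα hpos)]
      constructor
      · rintro (⟨h, h'⟩ | ⟨h, h'⟩)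
        · subst h
          exact absurd hone (not_lt.2 h')
        · exact aux_inj K hK B N P α a hN hP hm (h'.trans hTa.symm) (h' ▸ hPb')
      · intro h
        subst h
        exact Or.inr ⟨ha1, hTa⟩
  · intro α hα hα1
    have hE : Bleq B K / (Bleq B K / (Q * N)) = N * Q := by
      field_simp
    have hE2 : B K / (Bleq B K / (Q * N)) = (Q * B K / Bleq B K) * N := by
      field_simp
    generalize Bleq B K / (Q * N) = P at *
    have hle : totalN K N P α B ≤ N * Q := hE ▸ aux_le K B N P α
    rw [aux_eq K B N Q P α hN hα hα1 (aux_pos K hK B N P α hN hPbar hα hpos)]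
    constructor
    · rintro (⟨h, h'⟩ | ⟨h, h'⟩)
      · subst h
        refine ⟨?_, le_rfl⟩
        rw [lt_div_iff₀ hBK] at hQlow
        rw [div_le_one hBl]
        exact hQlow.le
      · refine ⟨?_, hα1⟩
        by_contra hcon
        rw [not_le] at hcon
        have h3 : α * N < B K / P := by
          rw [hE2]; exact mul_lt_mul_of_pos_right hcon hN
        have h4 := aux_strict K hK B N P α _ hN hcon h3
        have h5 := aux_le K B N P (Q * B K / Bleq B K)
        linarith
    · rintro ⟨h, _⟩
      rcases hα1.eq_or_lt with h1 | h1
      · exact Or.inl ⟨h1, hle⟩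
      · refine Or.inr ⟨h1, ?_⟩
        rw [← hE]
        apply aux_full K B N P α hPbar hm
        rw [hE2]
        exact mul_le_mul_of_nonneg_right h hN.le
end

section
/- (High benefit, linear case) Suppose CN > K. Then for every price P > 0, a participation rate α ∈ (0,1] is an equilibrium at price P (in the linear-benefit sense) if and only if α = 1. -/
open Finset

/-- High benefit, linear case: if `CN > K`, then for every
`P > 0`, `α ∈ (0,1]` is an equilibrium (linear-benefit sense) iff `α = 1`. -/
theorem high_benefit_linear
    (K : ℕ) (hK : 1 ≤ K) (B : ℕ → ℝ)
    (hB1 : 0 < B 1) (hBmono : ∀ k, 1 ≤ k → k < K → B k ≤ B (k + 1))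
    (N C : ℝ) (hN : 0 < N) (hC : 0 < C) (hCN : (K : ℝ) < C * N) :
    ∀ P : ℝ, 0 < P → ∀ α : ℝ, 0 < α → α ≤ 1 →
      (eqCondLin K B N C P α ↔ α = 1) := by
  intro P hP α h0 h1
  have hBpos : ∀ k, 1 ≤ k → k ≤ K → 0 < B k := by
    intro k hk
    induction k, hk using Nat.le_induction with
    | base => intro _; exact hB1
    | succ n hn ih =>
      intro h
      exact lt_of_lt_of_le (ih (by omega)) (hBmono n hn (by omega))
  have hT0 : 0 < totalN K N P α B := by
    unfold totalN
    apply Finset.sum_pos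
    · intro k hk
      rw [Finset.mem_Icc] at hk
      exact lt_min (mul_pos h0 hN) (div_pos (hBpos k hk.1 hk.2) hP)
    · exact ⟨1, Finset.mem_Icc.2 ⟨le_refl 1, hK⟩⟩
  have hT1 : totalN K N P α B ≤ K * (α * N) := by
    unfold totalN
    calc _ ≤ ∑ k ∈ Finset.Icc 1 K, α * N :=
          Finset.sum_le_sum (fun k _ => min_le_left _ _)
      _ = K * (α * N) := by simp
  have hlt : α < C * α ^ 2 * N ^ 2 / totalN K N P α B := by
    rw [lt_div_iff₀ hT0]
    have e1 : α * totalN K N P α B ≤ α * (K * (α * N)) :=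
      mul_le_mul_of_nonneg_left hT1 h0.le
    have e2 : (K : ℝ) * (α ^ 2 * N) < C * N * (α ^ 2 * N) :=
      mul_lt_mul_of_pos_right hCN (by positivity)
    linarith
  unfold eqCondLin
  constructor
  · intro h
    by_contra hne
    have hl : α < 1 := lt_of_le_of_ne h1 hne
    exact absurd h (lt_min hl hlt).ne
  · intro h
    rw [min_eq_left]
    · exact h
    · linarith
end

section
/- (Special case, linear benefit) Suppose CN = K. Then for every price P > 0: (i) α = 1 is an equilibrium at price P; (ii) a rate α with 0 < α < 1 is an equilibrium at price P if and only if α ≤ B_1/(PN); and (iii) every equilibrium α with 0 < α < 1 has buyer threshold k* = 0, i.e., N_k(α) = αN for all 1 ≤ k ≤ K. -/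
open Finset

theorem B_ge_aux (K : ℕ) (B : ℕ → ℝ)
    (hBmono : ∀ k, 1 ≤ k → k < K → B k ≤ B (k + 1)) :
    ∀ k, 1 ≤ k → k ≤ K → B 1 ≤ B k := by
  intro k hk
  induction k, hk using Nat.le_induction with
  | base => intro _; exact le_refl _
  | succ n hn ih =>
    intro h
    exact (ih (by omega)).trans (hBmono n hn (by omega))

theorem Nk_le_aux (N P α : ℝ) (B : ℕ → ℝ) (k : ℕ) : Nk N P α B k ≤ α * N := min_le_left _ _

theorem sum_const_aux (K : ℕ) (x : ℝ) : ∑ _k ∈ Finset.Icc 1 K, x = K * x := by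
  simp

theorem total_eq_iff_aux (K : ℕ) (B : ℕ → ℝ) (N P α : ℝ) :
    totalN K N P α B = K * (α * N) ↔ ∀ k, 1 ≤ k → k ≤ K → Nk N P α B k = α * N := by
  rw [← sum_const_aux, totalN,
    Finset.sum_eq_sum_iff_of_le (fun k _ => Nk_le_aux N P α B k)]
  simp only [Finset.mem_Icc, and_imp]

/-- Special case, linear benefit: if `CN = K`, then for every
`P > 0`: (i) `α = 1` is an equilibrium; (ii) `α ∈ (0,1)` is an equilibrium iff
`α ≤ B_1/(PN)`; (iii) every equilibrium `α ∈ (0,1)` is at buyer threshold `0`,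
i.e. `N_k(α) = αN` for all `1 ≤ k ≤ K`. -/
theorem special_case_linear
    (K : ℕ) (hK : 1 ≤ K) (B : ℕ → ℝ)
    (hB1 : 0 < B 1) (hBmono : ∀ k, 1 ≤ k → k < K → B k ≤ B (k + 1))
    (N C : ℝ) (hN : 0 < N) (hC : 0 < C) (hCN : C * N = (K : ℝ)) :
    ∀ P : ℝ, 0 < P →
      eqCondLin K B N C P 1 ∧
      (∀ α : ℝ, 0 < α → α < 1 →
        (eqCondLin K B N C P α ↔ α ≤ B 1 / (P * N))) ∧
      (∀ α : ℝ, 0 < α → α < 1 → eqCondLin K B N C P α →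
        ∀ k, 1 ≤ k → k ≤ K → Nk N P α B k = α * N) := by
  intro P hP
  have hBk := B_ge_aux K B hBmono
  have hKpos : (0 : ℝ) < K := by exact_mod_cast hK
  have hTpos : ∀ α : ℝ, 0 < α → 0 < totalN K N P α B := by
    intro α hα
    apply Finset.sum_pos
    · intro k hk
      rw [Finset.mem_Icc] at hk
      exact lt_min (mul_pos hα hN) (div_pos (hB1.trans_le (hBk k hk.1 hk.2)) hP)
    · exact ⟨1, Finset.mem_Icc.2 ⟨le_refl _, hK⟩⟩
  have key : ∀ α : ℝ, 0 < α → α < 1 → (eqCondLin K B N C P α ↔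
      ∀ k, 1 ≤ k → k ≤ K → Nk N P α B k = α * N) := by
    intro α hα hα1
    rw [← total_eq_iff_aux, eqCondLin]
    have hT := hTpos α hα
    have hnum : C * α ^ 2 * N ^ 2 = α * (K * (α * N)) := by rw [← hCN]; ring
    rw [hnum]
    constructor
    · intro h
      rcases min_choice 1 (α * (K * (α * N)) / totalN K N P α B) with h1 | h1
      · rw [h1] at h; linarith
      · rw [h1, eq_div_iff hT.ne'] at h
        exact mul_left_cancel₀ hα.ne' h
    · intro h
      rw [← h, mul_div_assoc, div_self hT.ne', mul_one, min_eq_right hα1.le]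
  refine ⟨?_, ?_, fun α h0 h1 h => (key α h0 h1).1 h⟩
  · have hT := hTpos 1 one_pos
    have hle : totalN K N P 1 B ≤ K * (1 * N) := by
      rw [← sum_const_aux]
      exact Finset.sum_le_sum (fun k _ => Nk_le_aux N P 1 B k)
    rw [eqCondLin, eq_comm, min_eq_left_iff, le_div_iff₀ hT]
    have : C * 1 ^ 2 * N ^ 2 = K * (1 * N) := by rw [← hCN]; ring
    rw [this, one_mul]
    exact hle
  · intro α h0 h1
    rw [key α h0 h1]
    have hiff : α ≤ B 1 / (P * N) ↔ α * N ≤ B 1 / P := by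
      rw [le_div_iff₀ (mul_pos hP hN), le_div_iff₀ hP]
      constructor <;> intro h <;> linarith
    rw [hiff]
    constructor
    · intro h
      exact min_eq_left_iff.1 (h 1 (le_refl _) hK)
    · intro h k hk1 hk2
      exact min_eq_left (h.trans (div_le_div_of_nonneg_right (hBk k hk1 hk2) hP.le))
end

section
/- (No equilibria at small buyer thresholds, linear low-benefit case) Suppose CN < K. Then for every integer k* with 0 ≤ k* ≤ K − CN, there is no price P > 0 and no α ∈ (0,1] that is an equilibrium at price P at buyer threshold k*. -/
open Finset

/-- No equilibria at small buyer thresholds, linear low-benefit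
case: if `CN < K`, then for every integer `k*` with `0 ≤ k* ≤ K − CN` there is no
price `P > 0` and no `α ∈ (0,1]` that is an equilibrium at price `P` at buyer
threshold `k*`. -/
theorem no_equilibria_small_threshold_linear
    (K : ℕ) (hK : 1 ≤ K) (B : ℕ → ℝ)
    (hB1 : 0 < B 1) (hBmono : ∀ k, 1 ≤ k → k < K → B k ≤ B (k + 1))
    (N C : ℝ) (hN : 0 < N) (hC : 0 < C) (hCN : C * N < (K : ℝ)) :
    ∀ kstar : ℕ, (kstar : ℝ) ≤ (K : ℝ) - C * N →
      ¬ ∃ P : ℝ, 0 < P ∧ ∃ α : ℝ, 0 < α ∧ α ≤ 1 ∧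
        eqCondLin K B N C P α ∧ atThr K B N P α kstar := by
  rintro kstar hk ⟨P, hP, α, hα, hα1, heq, hthr1, hthr2⟩
  have hCNpos : 0 < C * N := mul_pos hC hN
  have hαN : 0 < α * N := mul_pos hα hN
  have hkK : kstar < K := by
    have : (kstar : ℝ) < K := by linarith
    exact_mod_cast this
  have hBpos : ∀ k, 1 ≤ k → k ≤ K → 0 < B k := by
    intro k h1
    induction k, h1 using Nat.le_induction with
    | base => intro _; exact hB1
    | succ n hn ih =>
      intro h
      exact lt_of_lt_of_le (ih (by omega)) (hBmono n hn (by omega))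
  have hNk : ∀ k, 1 ≤ k → k ≤ K → 0 < Nk N P α B k := fun k h1 h2 =>
    lt_min hαN (div_pos (hBpos k h1 h2) hP)
  have hsum : ∑ k ∈ Finset.Icc (kstar + 1) K, Nk N P α B k = ((K : ℝ) - kstar) * (α * N) := by
    rw [Finset.sum_congr rfl (g := fun _ => α * N)]
    · rw [Finset.sum_const, Nat.card_Icc, nsmul_eq_mul]
      congr 1
      rw [Nat.add_sub_add_right, Nat.cast_sub hkK.le]
    · intro k hk'
      rw [Finset.mem_Icc] at hk'
      exact hthr2 k (by omega) hk'.2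
  have hT : C * N * (α * N) < totalN K N P α B := by
    unfold totalN
    rcases Nat.eq_zero_or_pos kstar with h0 | h0
    · subst h0
      rw [Nat.zero_add] at hsum
      rw [hsum]
      apply mul_lt_mul_of_pos_right _ hαN
      simpa using hCN
    · refine lt_of_le_of_lt (b := ((K : ℝ) - kstar) * (α * N)) ?_ ?_
      · apply mul_le_mul_of_nonneg_right _ hαN.le
        linarith
      · rw [← hsum]
        refine Finset.sum_lt_sum_of_subset (i := 1) ?_ ?_ ?_ (hNk 1 le_rfl hK) ?_
        · exact Finset.Icc_subset_Icc_left (by omega)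
        · simp [hK]
        · simp; omega
        · intro j hj _
          rw [Finset.mem_Icc] at hj
          exact (hNk j hj.1 hj.2).le
  have hTpos : 0 < totalN K N P α B := lt_trans (mul_pos hCNpos hαN) hT
  have hle : α ≤ C * α ^ 2 * N ^ 2 / totalN K N P α B := by
    unfold eqCondLin at heq
    exact heq.trans_le (min_le_right _ _)
  rw [le_div_iff₀ hTpos] at hle
  have := mul_lt_mul_of_pos_left hT hα
  nlinarith
end

section
/- (Closed form for partial participation, linear case) Suppose CN < K and fix an integer k* ∈ {0,1,…,K} with k* > K − CN. If α with 0 < α < 1 is an equilibrium at price P > 0 at buyer threshold k*, then α = B_{≤k*} / ((CN² − N(K − k*)) · P). -/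
open Finset

/-- Closed form for partial participation, linear case: suppose
`CN < K` and `k* ∈ {0,…,K}` with `k* > K − CN`. If `α ∈ (0,1)` is an equilibrium
at price `P > 0` at buyer threshold `k*`, then
`α = B_{≤k*} / ((CN² − N(K − k*)) · P)`. -/
theorem partial_closed_form_linear
    (K : ℕ) (hK : 1 ≤ K) (B : ℕ → ℝ)
    (hB1 : 0 < B 1) (hBmono : ∀ k, 1 ≤ k → k < K → B k ≤ B (k + 1))
    (N C : ℝ) (hN : 0 < N) (hC : 0 < C) (hCN : C * N < (K : ℝ))
    (kstar : ℕ) (hksK : kstar ≤ K) (hks : (K : ℝ) - C * N < (kstar : ℝ))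
    (P : ℝ) (hP : 0 < P) (α : ℝ) (hα0 : 0 < α) (hα1 : α < 1)
    (heq : eqCondLin K B N C P α) (hthr : atThr K B N P α kstar) :
    α = Bleq B kstar / ((C * N ^ 2 - N * ((K : ℝ) - (kstar : ℝ))) * P) := by
  have e : ∀ m, Finset.Icc 1 m = Finset.Ioc 0 m := by
    intro m
    ext x
    simp only [Finset.mem_Icc, Finset.mem_Ioc]
    omega
  have hT : totalN K N P α B = Bleq B kstar / P + ((K : ℝ) - kstar) * (α * N) := by
    unfold totalN Bleq
    rw [e, e, ← Finset.sum_Ioc_consecutive _ (Nat.zero_le kstar) hksK, Finset.sum_div]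
    congr 1
    · apply Finset.sum_congr rfl
      intro k hk
      rw [Finset.mem_Ioc] at hk
      have h := hthr.1 k hk.1 hk.2
      unfold Nk at h ⊢
      rcases min_choice (α * N) (B k / P) with h1 | h1
      · rw [h1] at h
        exact absurd h (lt_irrefl _)
      · exact h1
    · rw [Finset.sum_congr rfl (fun k hk => hthr.2 k (Finset.mem_Ioc.1 hk).1 (Finset.mem_Ioc.1 hk).2)]
      rw [Finset.sum_const, Nat.card_Ioc, nsmul_eq_mul, Nat.cast_sub hksK]
  have h2 : α = C * α ^ 2 * N ^ 2 / totalN K N P α B := by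
    unfold eqCondLin at heq
    rcases min_choice 1 (C * α ^ 2 * N ^ 2 / totalN K N P α B) with h1 | h1
    · rw [h1] at heq
      linarith
    · rw [h1] at heq
      exact heq
  have hT0 : totalN K N P α B ≠ 0 := by
    intro h
    rw [h, div_zero] at h2
    linarith
  rw [eq_div_iff hT0] at h2
  have h3 : totalN K N P α B = C * α * N ^ 2 := by
    apply mul_left_cancel₀ hα0.ne'
    rw [h2]
    ring
  have hD : 0 < C * N ^ 2 - N * ((K : ℝ) - (kstar : ℝ)) := by
    have := mul_pos hN (sub_pos.2 hks)
    nlinarith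
  rw [hT] at h3
  rw [eq_div_iff (mul_pos hD hP).ne']
  have h4 : Bleq B kstar / P = α * (C * N ^ 2 - N * ((K : ℝ) - (kstar : ℝ))) := by
    linarith
  rw [div_eq_iff hP.ne'] at h4
  rw [h4]
  ring
end

section
/- (Conditions for partial participation, linear case) Suppose CN < K and fix an integer k* ∈ {0,1,…,K} with k* > K − CN. There exists an equilibrium at price P > 0 at buyer threshold k* with 0 < α < 1 if and only if P > B_{≤k*}/(CN² − N(K − k*)) and B_{k*} < B_{≤k*}/(CN − (K − k*)) ≤ B_{k*+1}, where B_{K+1} = +∞ so the upper inequality is vacuous for k* = K. -/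
open Finset

theorem totalN_of_atThr (K : ℕ) (B : ℕ → ℝ) (N P α : ℝ) (m : ℕ) (hm : m ≤ K)
    (h : atThr K B N P α m) :
    totalN K N P α B = Bleq B m / P + ((K : ℝ) - m) * (α * N) := by
  obtain ⟨h1, h2⟩ := h
  have hd : Finset.Icc 1 K = Finset.Icc 1 m ∪ Finset.Ioc m K := by
    ext x; simp only [Finset.mem_Icc, Finset.mem_union, Finset.mem_Ioc]; omega
  have hdis : Disjoint (Finset.Icc 1 m) (Finset.Ioc m K) := by
    rw [Finset.disjoint_left]; intro x; simp only [Finset.mem_Icc, Finset.mem_Ioc]; omega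
  unfold totalN Bleq
  rw [hd, Finset.sum_union hdis, Finset.sum_div]
  congr 1
  · apply Finset.sum_congr rfl
    intro k hk
    rw [Finset.mem_Icc] at hk
    have := h1 k hk.1 hk.2
    unfold Nk at this ⊢
    rcases min_choice (α * N) (B k / P) with h | h
    · rw [h] at this; exact absurd this (lt_irrefl _)
    · exact h
  · rw [Finset.sum_congr rfl (g := fun _ => α * N)]
    · simp [Nat.cast_sub hm]
    · intro k hk
      rw [Finset.mem_Ioc] at hk
      exact h2 k hk.1 hk.2

/-- Conditions for partial participation, linear case: suppose
`CN < K` and `k* ∈ {0,…,K}` with `k* > K − CN`. There exists an equilibrium at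
price `P > 0` at buyer threshold `k*` with `0 < α < 1` iff
`P > B_{≤k*}/(CN² − N(K − k*))` and
`B_{k*} < B_{≤k*}/(CN − (K − k*)) ≤ B_{k*+1}` (the upper inequality being vacuous
for `k* = K`, interpreting `B_{K+1} = +∞`). -/
theorem partial_conditions_linear
    (K : ℕ) (hK : 1 ≤ K) (B : ℕ → ℝ)
    (hB1 : 0 < B 1) (hBmono : ∀ k, 1 ≤ k → k < K → B k ≤ B (k + 1))
    (N C : ℝ) (hN : 0 < N) (hC : 0 < C) (hCN : C * N < (K : ℝ))
    (kstar : ℕ) (hksK : kstar ≤ K) (hks : (K : ℝ) - C * N < (kstar : ℝ))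
    (P : ℝ) (hP : 0 < P) :
    (∃ α : ℝ, 0 < α ∧ α < 1 ∧
        eqCondLin K B N C P α ∧ atThr K B N P α kstar) ↔
      (Bleq B kstar / (C * N ^ 2 - N * ((K : ℝ) - (kstar : ℝ))) < P ∧
        B kstar < Bleq B kstar / (C * N - ((K : ℝ) - (kstar : ℝ))) ∧
        (kstar < K →
          Bleq B kstar / (C * N - ((K : ℝ) - (kstar : ℝ))) ≤ B (kstar + 1))) := by
  have hD : 0 < C * N - ((K : ℝ) - (kstar : ℝ)) := by linarith
  have hk1 : 1 ≤ kstar := by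
    have : (0 : ℝ) < kstar := by linarith
    exact_mod_cast this
  have hmono : ∀ i j, 1 ≤ i → i ≤ j → j ≤ K → B i ≤ B j := by
    intro i j hi hij
    induction j, hij using Nat.le_induction with
    | base => intro _; exact le_rfl
    | succ j hj ih => intro hjK; exact (ih (by omega)).trans (hBmono j (by omega) (by omega))
  have hBpos : ∀ k, 1 ≤ k → k ≤ K → 0 < B k := fun k h h' =>
    hB1.trans_le (hmono 1 k le_rfl h h')
  have hS : 0 < Bleq B kstar := by
    unfold Bleq
    apply Finset.sum_pos
    · intro k hk
      rw [Finset.mem_Icc] at hk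
      exact hBpos k hk.1 (hk.2.trans hksK)
    · exact ⟨1, Finset.mem_Icc.2 ⟨le_rfl, hk1⟩⟩
  have hKk : (0 : ℝ) ≤ (K : ℝ) - kstar := by
    have : (kstar : ℝ) ≤ K := by exact_mod_cast hksK
    linarith
  have hfac : C * N ^ 2 - N * ((K : ℝ) - (kstar : ℝ)) =
      (C * N - ((K : ℝ) - (kstar : ℝ))) * N := by ring
  rw [hfac, ← div_div, div_lt_iff₀ hN]
  have hXD : Bleq B kstar / (C * N - ((K : ℝ) - (kstar : ℝ))) *
      (C * N - ((K : ℝ) - (kstar : ℝ))) = Bleq B kstar := div_mul_cancel₀ _ hD.ne'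
  have hX : 0 < Bleq B kstar / (C * N - ((K : ℝ) - (kstar : ℝ))) := div_pos hS hD
  constructor
  · rintro ⟨α, h0, h1, he, ht⟩
    have hT := totalN_of_atThr K B N P α kstar hksK ht
    have hTpos : 0 < totalN K N P α B := by
      rw [hT]; have := div_pos hS hP; positivity
    have he2 : α = C * α ^ 2 * N ^ 2 / totalN K N P α B := by
      unfold eqCondLin at he
      rcases min_choice 1 (C * α ^ 2 * N ^ 2 / totalN K N P α B) with h | h
      · rw [h] at he; linarith
      · rwa [h] at he
    rw [eq_div_iff hTpos.ne'] at he2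
    have he3 : totalN K N P α B = C * α * N ^ 2 := by
      apply mul_left_cancel₀ h0.ne'; rw [he2]; ring
    have he4 : Bleq B kstar / P = α * N * (C * N - ((K : ℝ) - (kstar : ℝ))) := by
      linarith
    have hXe : Bleq B kstar / (C * N - ((K : ℝ) - (kstar : ℝ))) = α * N * P := by
      rw [div_eq_iff hP.ne'] at he4
      rw [div_eq_iff hD.ne', he4]; ring
    rw [hXe]
    refine ⟨?_, ?_, ?_⟩
    · nlinarith [mul_pos hN hP]
    · have := ht.1 kstar hk1 le_rfl
      unfold Nk at this
      rw [min_lt_iff] at this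
      rcases this with h | h
      · exact absurd h (lt_irrefl _)
      · rwa [div_lt_iff₀ hP] at h
    · intro hlt
      have := ht.2 (kstar + 1) (by omega) hlt
      unfold Nk at this
      rw [min_eq_left_iff] at this
      rwa [le_div_iff₀ hP] at this
  · rintro ⟨h1, h2, h3⟩
    set X := Bleq B kstar / (C * N - ((K : ℝ) - (kstar : ℝ))) with hXdef
    have hNP : 0 < N * P := mul_pos hN hP
    have hα : X / (N * P) * N = X / P := by field_simp
    have hα0 : 0 < X / (N * P) := div_pos hX hNP
    have hα1 : X / (N * P) < 1 := by rw [div_lt_one hNP]; linarith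
    have ht : atThr K B N P (X / (N * P)) kstar := by
      unfold atThr Nk
      rw [hα]
      constructor
      · intro k hk hk'
        apply min_lt_of_right_lt
        exact div_lt_div_of_pos_right ((hmono k kstar hk hk' hksK).trans_lt h2) hP
      · intro k hk hk'
        apply min_eq_left
        exact div_le_div_of_nonneg_right
          ((h3 (by omega)).trans (hmono (kstar + 1) k (by omega) hk hk')) hP.le
    refine ⟨X / (N * P), hα0, hα1, ?_, ht⟩
    have hT : totalN K N P (X / (N * P)) B = C * (X / (N * P)) * N ^ 2 := by
      rw [totalN_of_atThr K B N P _ kstar hksK ht, ← hXD]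
      field_simp
      ring
    unfold eqCondLin
    rw [hT]
    have : C * (X / (N * P)) ^ 2 * N ^ 2 / (C * (X / (N * P)) * N ^ 2) = X / (N * P) := by
      rw [div_eq_iff (by positivity)]; ring
    rw [this, min_eq_right hα1.le]
end

section
/- (Conditions for full participation, linear case) Suppose CN < K and fix an integer k* ∈ {0,1,…,K} with k* > K − CN. There exists an equilibrium at price P > 0 at buyer threshold k* with α = 1 if and only if B_{k*}/N < P ≤ B_{k*+1}/N and P ≥ B_{≤k*}/(CN² − N(K − k*)), where B_{K+1} = +∞ so the upper inequality is vacuous for k* = K. -/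
open Finset

/-- Conditions for full participation, linear case: suppose
`CN < K` and `k* ∈ {0,…,K}` with `k* > K − CN`. There exists an equilibrium at
price `P > 0` at buyer threshold `k*` with `α = 1` iff `B_{k*}/N < P ≤ B_{k*+1}/N`
(the upper inequality being vacuous for `k* = K`, interpreting `B_{K+1} = +∞`)
and `P ≥ B_{≤k*}/(CN² − N(K − k*))`. -/
theorem full_conditions_linear
    (K : ℕ) (hK : 1 ≤ K) (B : ℕ → ℝ)
    (hB1 : 0 < B 1) (hBmono : ∀ k, 1 ≤ k → k < K → B k ≤ B (k + 1))
    (N C : ℝ) (hN : 0 < N) (hC : 0 < C) (hCN : C * N < (K : ℝ))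
    (kstar : ℕ) (hksK : kstar ≤ K) (hks : (K : ℝ) - C * N < (kstar : ℝ))
    (P : ℝ) (hP : 0 < P) :
    (eqCondLin K B N C P 1 ∧ atThr K B N P 1 kstar) ↔
      (B kstar / N < P ∧ (kstar < K → P ≤ B (kstar + 1) / N) ∧
        Bleq B kstar / (C * N ^ 2 - N * ((K : ℝ) - (kstar : ℝ))) ≤ P) := by
  have hk0 : 1 ≤ kstar := by
    rcases Nat.eq_zero_or_pos kstar with h | h
    · subst h
      push_cast at hks
      linarith
    · exact h
  have mono : ∀ a b, 1 ≤ a → a ≤ b → b ≤ K → B a ≤ B b := by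
    intro a b ha hab
    induction b, hab using Nat.le_induction with
    | base => intro _; exact le_rfl
    | succ n hn ih =>
      intro hnK
      exact (ih (by omega)).trans (hBmono n (by omega) (by omega))
  have hBpos : ∀ k, 1 ≤ k → k ≤ K → 0 < B k := fun k h1 h2 =>
    lt_of_lt_of_le hB1 (mono 1 k le_rfl h1 h2)
  have hthr : atThr K B N P 1 kstar ↔
      (B kstar / N < P ∧ (kstar < K → P ≤ B (kstar + 1) / N)) := by
    unfold atThr Nk
    simp only [one_mul, min_lt_iff, lt_irrefl, false_or, min_eq_left_iff]
    constructor
    · rintro ⟨h1, h2⟩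
      refine ⟨?_, fun h => ?_⟩
      · have := h1 kstar hk0 le_rfl
        rw [div_lt_iff₀ hP] at this
        rw [div_lt_iff₀ hN]
        linarith
      · have := h2 (kstar + 1) (by omega) (by omega)
        rw [le_div_iff₀ hP] at this
        rw [le_div_iff₀ hN]
        linarith
    · rintro ⟨h1, h2⟩
      refine ⟨fun k hk hkk => ?_, fun k hk hkK => ?_⟩
      · have := mono k kstar hk hkk hksK
        rw [div_lt_iff₀ hN] at h1
        rw [div_lt_iff₀ hP]
        linarith
      · have := mono (kstar + 1) k (by omega) hk hkK
        have h3 := h2 (by omega)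
        rw [le_div_iff₀ hN] at h3
        rw [le_div_iff₀ hP]
        linarith
  have hpos : 0 < totalN K N P 1 B := by
    unfold totalN Nk
    apply Finset.sum_pos
    · intro k hk
      rw [Finset.mem_Icc] at hk
      have := hBpos k hk.1 hk.2
      apply lt_min <;> positivity
    · exact ⟨1, by simp [hK]⟩
  have hD : 0 < C * N ^ 2 - N * ((K : ℝ) - (kstar : ℝ)) := by
    have : 0 < N * (C * N - ((K : ℝ) - (kstar : ℝ))) := mul_pos hN (by linarith)
    linarith
  have heq : atThr K B N P 1 kstar → (eqCondLin K B N C P 1 ↔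
      Bleq B kstar / (C * N ^ 2 - N * ((K : ℝ) - (kstar : ℝ))) ≤ P) := by
    rintro ⟨h1, h2⟩
    have htot : totalN K N P 1 B = Bleq B kstar / P + N * ((K : ℝ) - (kstar : ℝ)) := by
      have hs : Finset.Icc 1 K = Finset.Icc 1 kstar ∪ Finset.Ioc kstar K := by
        ext x
        simp only [Finset.mem_union, Finset.mem_Icc, Finset.mem_Ioc]
        omega
      have hd : Disjoint (Finset.Icc 1 kstar) (Finset.Ioc kstar K) := by
        rw [Finset.disjoint_left]
        intro x
        simp only [Finset.mem_Icc, Finset.mem_Ioc]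
        omega
      unfold totalN Bleq
      rw [hs, Finset.sum_union hd, Finset.sum_div]
      congr 1
      · apply Finset.sum_congr rfl
        intro k hk
        rw [Finset.mem_Icc] at hk
        have := h1 k hk.1 hk.2
        unfold Nk at this ⊢
        rw [min_lt_iff] at this
        rcases this with h | h
        · exact absurd h (lt_irrefl _)
        · exact min_eq_right h.le
      · rw [Finset.sum_congr rfl (g := fun _ => N)]
        · rw [Finset.sum_const, Nat.card_Ioc, nsmul_eq_mul, Nat.cast_sub hksK]
          ring
        · intro k hk
          rw [Finset.mem_Ioc] at hk
          rw [h2 k hk.1 hk.2, one_mul]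
    unfold eqCondLin
    rw [eq_comm, min_eq_left_iff, le_div_iff₀ hpos, htot, div_le_iff₀ hD]
    have : Bleq B kstar / P ≤ C * N ^ 2 - N * ((K : ℝ) - (kstar : ℝ)) ↔
      Bleq B kstar ≤ P * (C * N ^ 2 - N * ((K : ℝ) - (kstar : ℝ))) := by
      rw [div_le_iff₀ hP, mul_comm]
    rw [← this]
    constructor <;> intro h <;> linarith
  constructor
  · rintro ⟨h1, h2⟩
    exact ⟨(hthr.1 h2).1, (hthr.1 h2).2, (heq h2).1 h1⟩
  · rintro ⟨h1, h2, h3⟩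
    have h := hthr.2 ⟨h1, h2⟩
    exact ⟨(heq h).2 h3, h⟩
end

section
/- (Low benefit, linear case) Suppose CN < K. Then there exists a price threshold P̄ > 0 such that: (i) for every 0 < P < P̄, there is no α ∈ (0,1] that is an equilibrium at price P; (ii) for every P ≥ P̄, α = 1 is an equilibrium at price P; and (iii) there exists a constant A > 0 such that for every P > P̄ there is a unique equilibrium α at price P with 0 < α < 1 and it equals α = A/P, if and only if there exists an integer k̂ ∈ {1,…,K} with k̂ > K − CN satisfying B_{k̂}/N < B_{≤k̂}/(CN² − N(K − k̂)) ≤ B_{k̂+1}/N (with B_{K+1} = +∞), in which case A = B_{≤k̂}/(CN² − N(K − k̂)). -/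
open Finset

/-- Rescaled total purchase as a function of `x = α P`. -/
noncomputable def SS (K : ℕ) (N : ℝ) (B : ℕ → ℝ) (x : ℝ) : ℝ :=
  ∑ k ∈ Finset.Icc 1 K, min (x * N) (B k)

lemma B_mono_aux (K : ℕ) (B : ℕ → ℝ) (hBmono : ∀ k, 1 ≤ k → k < K → B k ≤ B (k + 1))
    (i j : ℕ) (hi : 1 ≤ i) (hij : i ≤ j) (hj : j ≤ K) : B i ≤ B j := by
  induction j, hij using Nat.le_induction with
  | base => exact le_rfl
  | succ n hn ih => exact (ih (by omega)).trans (hBmono n (by omega) (by omega))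

lemma total_eq (K : ℕ) (N P α : ℝ) (B : ℕ → ℝ) (hP : 0 < P) :
    totalN K N P α B = SS K N B (α * P) / P := by
  unfold totalN SS Nk
  rw [Finset.sum_div]
  refine Finset.sum_congr rfl fun k _ => ?_
  rw [← min_div_div_right hP.le]
  congr 1
  field_simp

lemma SS_pos (K : ℕ) (hK : 1 ≤ K) (N x : ℝ) (B : ℕ → ℝ) (hN : 0 < N) (hx : 0 < x)
    (hB : ∀ k, 1 ≤ k → k ≤ K → 0 < B k) : 0 < SS K N B x := by
  unfold SS
  refine Finset.sum_pos (fun k hk => ?_) ⟨1, by simp [hK]⟩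
  rw [Finset.mem_Icc] at hk
  exact lt_min (by positivity) (hB k hk.1 hk.2)

lemma SS_key (K : ℕ) (hK : 1 ≤ K) (N C x y : ℝ) (B : ℕ → ℝ) (hN : 0 < N)
    (hCN : C * N < (K : ℝ)) (hx : 0 < x) (hxy : x < y)
    (hB : ∀ k, 1 ≤ k → k ≤ K → 0 < B k) (hB1 : ∀ k, 1 ≤ k → k ≤ K → B 1 ≤ B k)
    (h : SS K N B x ≤ C * N ^ 2 * x) : SS K N B y < C * N ^ 2 * y := by
  have h1 : B 1 < x * N := by
    by_contra hc
    push Not at hc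
    have : SS K N B x = K * (x * N) := by
      unfold SS
      rw [Finset.sum_congr rfl (g := fun _ => x * N)]
      · simp
      · intro k hk
        rw [Finset.mem_Icc] at hk
        exact min_eq_left (hc.trans (hB1 k hk.1 hk.2))
    have h2 : C * N * (x * N) < K * (x * N) := mul_lt_mul_of_pos_right hCN (by positivity)
    nlinarith
  have hy : 0 < y := hx.trans hxy
  have hyN : x * N < y * N := mul_lt_mul_of_pos_right hxy hN
  have h3 : SS K N B y * x < SS K N B x * y := by
    unfold SS
    rw [Finset.sum_mul, Finset.sum_mul]
    apply Finset.sum_lt_sum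
    · intro k hk
      rw [Finset.mem_Icc] at hk
      have hb := hB k hk.1 hk.2
      rw [min_mul_of_nonneg _ _ hx.le, min_mul_of_nonneg _ _ hy.le]
      apply min_le_min
      · apply le_of_eq; ring
      · exact mul_le_mul_of_nonneg_left hxy.le hb.le
    · refine ⟨1, by simp [hK], ?_⟩
      rw [min_eq_right h1.le, min_eq_right (h1.trans hyN).le]
      exact mul_lt_mul_of_pos_left hxy (hB 1 le_rfl hK)
  have h4 : SS K N B x * y ≤ C * N ^ 2 * x * y := mul_le_mul_of_nonneg_right h hy.le
  have h5 : SS K N B y * x < C * N ^ 2 * y * x := by nlinarith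
  exact lt_of_mul_lt_mul_right h5 hx.le

lemma SS_split (K m : ℕ) (hm : m ≤ K) (N x : ℝ) (B : ℕ → ℝ)
    (h1 : ∀ k, 1 ≤ k → k ≤ m → B k ≤ x * N) (h2 : ∀ k, m < k → k ≤ K → x * N ≤ B k) :
    SS K N B x = Bleq B m + ((K : ℝ) - m) * (x * N) := by
  unfold SS Bleq
  have e : ∀ n, Finset.Icc 1 n = Finset.Ioc 0 n := fun n => by
    ext; simp [Nat.succ_le_iff]
  rw [e, e, ← Finset.sum_Ioc_consecutive _ (Nat.zero_le m) hm]
  congr 1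
  · refine Finset.sum_congr rfl fun k hk => ?_
    rw [Finset.mem_Ioc] at hk
    exact min_eq_right (h1 k hk.1 hk.2)
  · rw [Finset.sum_congr rfl (g := fun _ => x * N)]
    · simp [Nat.cast_sub hm]
    · intro k hk
      rw [Finset.mem_Ioc] at hk
      exact min_eq_left (h2 k hk.1 hk.2)

lemma SS_root (K : ℕ) (hK : 1 ≤ K) (N C : ℝ) (B : ℕ → ℝ) (hN : 0 < N) (hC : 0 < C)
    (hCN : C * N < (K : ℝ))
    (hB : ∀ k, 1 ≤ k → k ≤ K → 0 < B k) (hB1 : ∀ k, 1 ≤ k → k ≤ K → B 1 ≤ B k) :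
    ∃ x, 0 < x ∧ SS K N B x = C * N ^ 2 * x := by
  have hb := hB 1 le_rfl hK
  have hBl : 0 < Bleq B K := by
    refine Finset.sum_pos (fun k hk => ?_) ⟨1, by simp [hK]⟩
    rw [Finset.mem_Icc] at hk
    exact hB k hk.1 hk.2
  have hcont : Continuous (fun x => SS K N B x - C * N ^ 2 * x) := by
    unfold SS
    fun_prop
  have ha : 0 ≤ SS K N B (B 1 / N) - C * N ^ 2 * (B 1 / N) := by
    rw [SS_split K 0 (by omega) N _ B (by intro k; omega)
      (by intro k hk hk'; rw [div_mul_cancel₀ _ hN.ne']; exact hB1 k hk hk')]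
    rw [div_mul_cancel₀ _ hN.ne']
    have : C * N ^ 2 * (B 1 / N) = C * N * B 1 := by field_simp
    rw [this]
    simp [Bleq]
    exact mul_le_mul_of_nonneg_right hCN.le hb.le
  have hM : SS K N B (Bleq B K / (C * N ^ 2)) - C * N ^ 2 * (Bleq B K / (C * N ^ 2)) ≤ 0 := by
    rw [mul_div_cancel₀ _ (by positivity), sub_nonpos]
    exact Finset.sum_le_sum fun k _ => min_le_right _ _
  obtain ⟨x, hx, hx0⟩ := intermediate_value_uIcc
    (hcont.continuousOn (s := Set.uIcc (B 1 / N) (Bleq B K / (C * N ^ 2))))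
    (Set.mem_uIcc.2 (Or.inr ⟨hM, ha⟩))
  refine ⟨x, ?_, by simpa [sub_eq_zero] using hx0⟩
  have h0 : 0 < min (B 1 / N) (Bleq B K / (C * N ^ 2)) := lt_min (by positivity) (by positivity)
  exact h0.trans_le hx.1

/-- Low benefit, linear case: if `CN < K`, there is a price
threshold `P̄ > 0` such that (i) below `P̄` there is no equilibrium in `(0,1]`;
(ii) for `P ≥ P̄`, `α = 1` is an equilibrium; (iii) there exists `A > 0` such that
for every `P > P̄` there is a unique partial-participation equilibrium and it
equals `A/P`, iff there exists `k̂ ∈ {1,…,K}` with `k̂ > K − CN` and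
`B_{k̂}/N < B_{≤k̂}/(CN² − N(K − k̂)) ≤ B_{k̂+1}/N` (upper bound vacuous for
`k̂ = K`), in which case `A = B_{≤k̂}/(CN² − N(K − k̂))`. -/
theorem low_benefit_linear
    (K : ℕ) (hK : 1 ≤ K) (B : ℕ → ℝ)
    (hB1 : 0 < B 1) (hBmono : ∀ k, 1 ≤ k → k < K → B k ≤ B (k + 1))
    (N C : ℝ) (hN : 0 < N) (hC : 0 < C) (hCN : C * N < (K : ℝ)) :
    ∃ Pbar : ℝ, 0 < Pbar ∧
      (∀ P : ℝ, 0 < P → P < Pbar →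
        ¬ ∃ α : ℝ, 0 < α ∧ α ≤ 1 ∧ eqCondLin K B N C P α) ∧
      (∀ P : ℝ, Pbar ≤ P → eqCondLin K B N C P 1) ∧
      ((∃ A : ℝ, 0 < A ∧ ∀ P : ℝ, Pbar < P →
          (∃! α : ℝ, 0 < α ∧ α < 1 ∧ eqCondLin K B N C P α) ∧
          (∀ α : ℝ, 0 < α → α < 1 →
            (eqCondLin K B N C P α ↔ α = A / P))) ↔
        (∃ khat : ℕ, 1 ≤ khat ∧ khat ≤ K ∧ (K : ℝ) - C * N < (khat : ℝ) ∧
          B khat / N < Bleq B khat / (C * N ^ 2 - N * ((K : ℝ) - (khat : ℝ))) ∧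
          (khat < K →
            Bleq B khat / (C * N ^ 2 - N * ((K : ℝ) - (khat : ℝ))) ≤
              B (khat + 1) / N))) ∧
      (∀ khat : ℕ, 1 ≤ khat → khat ≤ K → (K : ℝ) - C * N < (khat : ℝ) →
        B khat / N < Bleq B khat / (C * N ^ 2 - N * ((K : ℝ) - (khat : ℝ))) →
        (khat < K →
          Bleq B khat / (C * N ^ 2 - N * ((K : ℝ) - (khat : ℝ))) ≤
            B (khat + 1) / N) →
        ∀ P : ℝ, Pbar < P →
          (∃! α : ℝ, 0 < α ∧ α < 1 ∧ eqCondLin K B N C P α) ∧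
          (∀ α : ℝ, 0 < α → α < 1 →
            (eqCondLin K B N C P α ↔
              α = (Bleq B khat / (C * N ^ 2 - N * ((K : ℝ) - (khat : ℝ)))) / P))) := by
  have hB1' : ∀ k, 1 ≤ k → k ≤ K → B 1 ≤ B k := fun k h1 h2 =>
    B_mono_aux K B hBmono 1 k le_rfl h1 h2
  have hB : ∀ k, 1 ≤ k → k ≤ K → 0 < B k := fun k h1 h2 => hB1.trans_le (hB1' k h1 h2)
  obtain ⟨x0, hx0, hroot⟩ := SS_root K hK N C B hN hC hCN hB hB1'
  have key := fun x y hx hxy => SS_key K hK N C x y B hN hCN hx hxy hB hB1'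
  have huniq : ∀ x, 0 < x → SS K N B x = C * N ^ 2 * x → x = x0 := by
    intro x hx h
    rcases lt_trichotomy x x0 with h1 | h1 | h1
    · exact absurd hroot (key x x0 hx h1 h.le).ne
    · exact h1
    · exact absurd h (key x0 x hx0 h1 hroot.le).ne
  have hpart : ∀ P α : ℝ, 0 < P → 0 < α → α < 1 → (eqCondLin K B N C P α ↔ α = x0 / P) := by
    intro P α hP hα hα1
    have hS := SS_pos K hK N (α * P) B hN (by positivity) hB
    have e1 : eqCondLin K B N C P α ↔ SS K N B (α * P) = C * N ^ 2 * (α * P) := by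
      unfold eqCondLin
      rw [total_eq K N P α B hP]
      have : α = min 1 (C * α ^ 2 * N ^ 2 / (SS K N B (α * P) / P)) ↔
          α = C * α ^ 2 * N ^ 2 / (SS K N B (α * P) / P) := by
        constructor
        · intro h
          rcases min_choice 1 (C * α ^ 2 * N ^ 2 / (SS K N B (α * P) / P)) with h' | h'
          · rw [h'] at h; exact absurd h hα1.ne
          · rw [h'] at h; exact h
        · intro h
          rw [← h, min_eq_right hα1.le]
      rw [this, eq_div_iff (by positivity), mul_div_assoc', div_eq_iff hP.ne']
      constructor
      · intro h
        apply mul_left_cancel₀ hα.ne'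
        rw [h]; ring
      · intro h
        rw [h]; ring
    rw [e1, eq_div_iff hP.ne']
    constructor
    · exact huniq _ (by positivity)
    · intro h
      rw [h, hroot]
  have hone : ∀ P : ℝ, 0 < P → (eqCondLin K B N C P 1 ↔ SS K N B P ≤ C * N ^ 2 * P) := by
    intro P hP
    have hS := SS_pos K hK N P B hN hP hB
    unfold eqCondLin
    rw [total_eq K N P 1 B hP, one_mul, eq_comm, min_eq_left_iff, le_div_iff₀ (by positivity),
      one_mul, div_le_iff₀ hP]
    simp
  have hall : ∀ P : ℝ, x0 < P → (∃! α : ℝ, 0 < α ∧ α < 1 ∧ eqCondLin K B N C P α) ∧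
      (∀ α : ℝ, 0 < α → α < 1 → (eqCondLin K B N C P α ↔ α = x0 / P)) := by
    intro P hP
    have hP0 : 0 < P := hx0.trans hP
    have hpos : 0 < x0 / P := by positivity
    have hlt : x0 / P < 1 := (div_lt_one hP0).2 hP
    refine ⟨⟨x0 / P, ⟨hpos, hlt, (hpart P _ hP0 hpos hlt).2 rfl⟩, ?_⟩,
      fun α h1 h2 => hpart P α hP0 h1 h2⟩
    rintro α ⟨h1, h2, h3⟩
    exact (hpart P α hP0 h1 h2).1 h3
  refine ⟨x0, hx0, ?_, ?_, ?_, ?_⟩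
  · rintro P hP hPlt ⟨α, hα, hα1, h⟩
    rcases hα1.lt_or_eq with h1 | h1
    · have h2 := (hpart P α hP hα h1).1 h
      rw [eq_div_iff hP.ne'] at h2
      nlinarith
    · rw [h1] at h
      exact absurd hroot (key P x0 hP hPlt ((hone P hP).1 h)).ne
  · intro P hP
    rw [hone P (hx0.trans_le hP)]
    rcases hP.lt_or_eq with h1 | h1
    · exact (key x0 P hx0 h1 hroot.le).le
    · rw [← h1]; exact hroot.le
  · refine ⟨fun _ => ?_, fun _ => ⟨x0, hx0, hall⟩⟩
    classical
    have hB1x : B 1 < x0 * N := by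
      by_contra hc
      push Not at hc
      have h1 := SS_split K 0 (by omega) N x0 B (by intro k; omega)
        (fun k hk hk' => hc.trans (hB1' k hk hk'))
      rw [hroot] at h1
      simp [Bleq] at h1
      have h2 : C * N * (x0 * N) < K * (x0 * N) := mul_lt_mul_of_pos_right hCN (by positivity)
      nlinarith
    obtain ⟨m, hm⟩ : ∃ m, m = Nat.findGreatest (fun k => B k < x0 * N) K := ⟨_, rfl⟩
    have hm1 : 1 ≤ m := hm ▸ Nat.le_findGreatest hK hB1x
    have hmK : m ≤ K := hm ▸ Nat.findGreatest_le K
    have hmB : B m < x0 * N :=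
      hm ▸ Nat.findGreatest_spec (P := fun k => B k < x0 * N) hK hB1x
    have hgt : ∀ k, m < k → k ≤ K → x0 * N ≤ B k := fun k hk hk' =>
      not_lt.1 (Nat.findGreatest_is_greatest (P := fun k => B k < x0 * N) (hm ▸ hk) hk')
    have hs := SS_split K m hmK N x0 B
      (fun k h1 h2 => (B_mono_aux K B hBmono k m h1 h2 hmK).trans hmB.le) hgt
    have hBl : 0 < Bleq B m := by
      refine Finset.sum_pos (fun k hk => ?_) ⟨1, by simp [hm1]⟩
      rw [Finset.mem_Icc] at hk
      exact hB k hk.1 (hk.2.trans hmK)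
    rw [hroot] at hs
    have hs' : x0 * (C * N ^ 2 - N * ((K : ℝ) - m)) = Bleq B m := by linarith
    have hD : 0 < C * N ^ 2 - N * ((K : ℝ) - m) := by
      rw [← hs'] at hBl
      exact pos_of_mul_pos_right hBl hx0.le
    have hq : Bleq B m / (C * N ^ 2 - N * ((K : ℝ) - m)) = x0 := by
      rw [div_eq_iff hD.ne', hs']
    refine ⟨m, hm1, hmK, ?_, ?_, ?_⟩
    · have : 0 < N * (C * N - ((K : ℝ) - m)) := by linarith
      have := pos_of_mul_pos_right this hN.le
      linarith
    · rw [hq, div_lt_iff₀ hN]; exact hmB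
    · intro h
      rw [hq, le_div_iff₀ hN]
      exact hgt (m + 1) (by omega) (by omega)
  · intro m hm1 hmK hmC h1 h2
    have hD : 0 < C * N ^ 2 - N * ((K : ℝ) - m) := by
      have : 0 < N * (C * N - ((K : ℝ) - m)) := mul_pos hN (by linarith)
      linarith
    have hBl : 0 < Bleq B m := by
      refine Finset.sum_pos (fun k hk => ?_) ⟨1, by simp [hm1]⟩
      rw [Finset.mem_Icc] at hk
      exact hB k hk.1 (hk.2.trans hmK)
    obtain ⟨q, hq⟩ : ∃ q, q = Bleq B m / (C * N ^ 2 - N * ((K : ℝ) - m)) := ⟨_, rfl⟩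
    rw [← hq] at h1 h2 ⊢
    have hq0 : 0 < q := hq ▸ div_pos hBl hD
    rw [div_lt_iff₀ hN] at h1
    have hs := SS_split K m hmK N q B
      (fun k h3 h4 => (B_mono_aux K B hBmono k m h3 h4 hmK).trans h1.le)
      (fun k h3 h4 => ((le_div_iff₀ hN).1 (h2 (by omega))).trans
        (B_mono_aux K B hBmono (m + 1) k (by omega) h3 h4))
    rw [eq_div_iff hD.ne'] at hq
    have : q = x0 := huniq q hq0 (by rw [hs, ← hq]; ring)
    rw [this]
    exact hall
end
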